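/- Let λ > 0, let x = (x₁,x₂,x₃) ∈ [−π,π)³, let w₂ = (1,−2,1)ᵀ so that ⟨x,w₂⟩ = x₁ − 2x₂ + x₃ and ‖w₂‖² = 6, and set s₂ := sgn((⟨x,w₂⟩)_{2π}). If |(⟨x,w₂⟩)_{2π}| < π, then the unique minimizer over y ∈ [−π,π)³ of (1/2)∑_{j=1}³ dist(x_j,y_j)² + λ·|(y₁ − 2y₂ + y₃)_{2π}| is the point (x − s₂·m₂·w₂)_{2π} (applied componentwise), where m₂ := min{λ, |(⟨x,w₂⟩)_{2π}|/6}. -/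

import Mathlib

open Real Set

/-- `wrap a` is the unique representative of `a` modulo `2π` lying in `[-π, π)`. -/
noncomputable def wrap (a : ℝ) : ℝ := a - 2 * π * ↑⌊(a + π) / (2 * π)⌋

lemma wrap_mem (a : ℝ) : wrap a ∈ Ico (-π) π := by
  have h2 : (0 : ℝ) < 2 * π := by positivity
  have h1 := (le_div_iff₀ h2).1 (Int.floor_le ((a + π) / (2 * π)))
  have h3 := (div_lt_iff₀ h2).1 (Int.lt_floor_add_one ((a + π) / (2 * π)))
  unfold wrap
  constructor <;> linarith

lemma exists_wrap_eq (a : ℝ) : ∃ k : ℤ, wrap a = a - 2 * π * k := ⟨_, rfl⟩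

/-- Two points of `[-π, π)` that agree modulo `2π` are equal. -/
lemma eq_of_mem_Ico_of_eq_sub {a b : ℝ} (ha : a ∈ Ico (-π) π) (hb : b ∈ Ico (-π) π) {k : ℤ}
    (h : b = a - 2 * π * k) : b = a := by
  have hπ := pi_pos
  obtain ⟨ha1, ha2⟩ := ha
  obtain ⟨hb1, hb2⟩ := hb
  have hk1 : (k : ℝ) < 1 := by nlinarith
  have hk2 : (-1 : ℝ) < k := by nlinarith
  have hk : k = 0 := by
    have h1 : k < 1 := by exact_mod_cast hk1
    have h2 : -1 < k := by exact_mod_cast hk2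
    omega
  simp [h, hk]

lemma wrap_eq_of_eq_sub {a b : ℝ} (hb : b ∈ Ico (-π) π) {k : ℤ} (h : b = a - 2 * π * k) :
    wrap a = b := by
  obtain ⟨j, hj⟩ := exists_wrap_eq a
  refine eq_of_mem_Ico_of_eq_sub (k := j - k) hb (wrap_mem a) ?_
  push_cast
  linarith

lemma wrap_sub_wrap_sub {x u : ℝ} (hu : u ∈ Ico (-π) π) : wrap (x - wrap (x - u)) = u := by
  obtain ⟨k, hk⟩ := exists_wrap_eq (x - u)
  refine wrap_eq_of_eq_sub (k := k) hu ?_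
  linarith

lemma eq_wrap_sub_wrap {x y : ℝ} (hy : y ∈ Ico (-π) π) : y = wrap (x - wrap (x - y)) :=
  (wrap_sub_wrap_sub hy (x := x)).symm

/-- Quadratic growth of the lifted objective `½‖v‖² + lam |e - ⟨v, w₂⟩|` around `m • w₂`,
where `0 ≤ m ≤ lam` and either `m = lam` or `6 m = d`. -/
lemma objective_growth {lam m d e v₁ v₂ v₃ : ℝ} (hm0 : 0 ≤ m) (hml : m ≤ lam)
    (hmd : lam * (d - 6 * m) = m * (d - 6 * m)) :
    3 * m ^ 2 + lam * (d - 6 * m) + m * (e - d) +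
        (1 / 2) * ((v₁ - m) ^ 2 + (v₂ + 2 * m) ^ 2 + (v₃ - m) ^ 2) ≤
      (1 / 2) * (v₁ ^ 2 + v₂ ^ 2 + v₃ ^ 2) + lam * |e - (v₁ - 2 * v₂ + v₃)| := by
  have h1 : m * (e - (v₁ - 2 * v₂ + v₃)) ≤ lam * |e - (v₁ - 2 * v₂ + v₃)| :=
    (mul_le_mul_of_nonneg_left (le_abs_self _) hm0).trans
      (mul_le_mul_of_nonneg_right hml (abs_nonneg _))
  nlinarith

/-- If moreover `d ≤ e`, the lifted objective has a lower bound attained only at `m • w₂`. -/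
lemma objective_min_of_le {lam m d e v₁ v₂ v₃ : ℝ} (hm0 : 0 ≤ m) (hml : m ≤ lam)
    (hmd : lam * (d - 6 * m) = m * (d - 6 * m)) (hde : d ≤ e) :
    3 * m ^ 2 + lam * (d - 6 * m) ≤
        (1 / 2) * (v₁ ^ 2 + v₂ ^ 2 + v₃ ^ 2) + lam * |e - (v₁ - 2 * v₂ + v₃)| ∧
      ((1 / 2) * (v₁ ^ 2 + v₂ ^ 2 + v₃ ^ 2) + lam * |e - (v₁ - 2 * v₂ + v₃)| =
        3 * m ^ 2 + lam * (d - 6 * m) →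
        v₁ = m ∧ v₂ = -2 * m ∧ v₃ = m ∧ m * (e - d) = 0) := by
  have h := objective_growth (e := e) (v₁ := v₁) (v₂ := v₂) (v₃ := v₃) hm0 hml hmd
  have h0 : 0 ≤ m * (e - d) := mul_nonneg hm0 (sub_nonneg.2 hde)
  have q₁ := sq_nonneg (v₁ - m)
  have q₂ := sq_nonneg (v₂ + 2 * m)
  have q₃ := sq_nonneg (v₃ - m)
  refine ⟨by linarith, fun heq => ?_⟩
  have e₁ : v₁ - m = 0 := pow_eq_zero_iff two_ne_zero |>.1 (by linarith)
  have e₂ : v₂ + 2 * m = 0 := pow_eq_zero_iff two_ne_zero |>.1 (by linarith)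
  have e₃ : v₃ - m = 0 := pow_eq_zero_iff two_ne_zero |>.1 (by linarith)
  exact ⟨by linarith, by linarith, by linarith, by linarith⟩

/-- The lifted objective with residual `e` congruent to `d` is minimized only at
`(sign d * m) • w₂`. -/
lemma objective_min {lam m d e v₁ v₂ v₃ : ℝ} (hlam : 0 < lam) (hm : m = min lam (|d| / 6))
    (hde : e = d ∨ |d| < |e|) :
    3 * m ^ 2 + lam * (|d| - 6 * m) ≤
        (1 / 2) * (v₁ ^ 2 + v₂ ^ 2 + v₃ ^ 2) + lam * |e - (v₁ - 2 * v₂ + v₃)| ∧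
      ((1 / 2) * (v₁ ^ 2 + v₂ ^ 2 + v₃ ^ 2) + lam * |e - (v₁ - 2 * v₂ + v₃)| =
        3 * m ^ 2 + lam * (|d| - 6 * m) →
        v₁ = Real.sign d * m ∧ v₂ = -2 * (Real.sign d * m) ∧ v₃ = Real.sign d * m) := by
  have hm0 : 0 ≤ m := hm ▸ le_min hlam.le (by positivity)
  have hml : m ≤ lam := hm ▸ min_le_left _ _
  have hmd : lam * (|d| - 6 * m) = m * (|d| - 6 * m) := by
    rcases min_choice lam (|d| / 6) with h | h <;> rw [h] at hm <;> subst hm <;> ring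
  have hle : |d| ≤ |e| := hde.elim (fun h => h ▸ le_rfl) le_of_lt
  have hsign : m * (|e| - |d|) = 0 → m = 0 ∨ (e = d ∧ d ≠ 0) := by
    intro h
    rcases eq_or_ne m 0 with h0 | h0
    · exact .inl h0
    · refine .inr ⟨hde.resolve_right fun hlt => ?_, fun hd => h0 ?_⟩
      · rcases mul_eq_zero.1 h with h | h
        · exact h0 h
        · linarith
      · rw [hm, hd]; simp [hlam.le]
  rcases le_total 0 e with he | he
  · obtain ⟨h1, h2⟩ := objective_min_of_le (v₁ := v₁) (v₂ := v₂) (v₃ := v₃) hm0 hml hmd hle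
    rw [abs_of_nonneg he] at h1 h2 hsign
    refine ⟨h1, fun heq => ?_⟩
    obtain ⟨e₁, e₂, e₃, h0⟩ := h2 heq
    rcases hsign h0 with h | ⟨rfl, hd⟩
    · subst e₁ e₂ e₃; simp [h]
    · rw [Real.sign_of_pos (lt_of_le_of_ne he hd.symm)]
      simp [e₁, e₂, e₃]
  · obtain ⟨h1, h2⟩ :=
      objective_min_of_le (v₁ := -v₁) (v₂ := -v₂) (v₃ := -v₃) hm0 hml hmd hle
    have habs : |-e - (-v₁ - 2 * -v₂ + -v₃)| = |e - (v₁ - 2 * v₂ + v₃)| := by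
      rw [← abs_neg]; congr 1; ring
    rw [abs_of_nonpos he] at h1 h2 hsign
    simp only [habs, neg_sq] at h1 h2
    refine ⟨h1, fun heq => ?_⟩
    obtain ⟨e₁, e₂, e₃, h0⟩ := h2 heq
    rcases hsign h0 with h | ⟨rfl, hd⟩
    · rw [h] at e₁ e₂ e₃ ⊢
      exact ⟨by linarith, by linarith, by linarith⟩
    · rw [Real.sign_of_neg (lt_of_le_of_ne he hd)]
      exact ⟨by linarith, by linarith, by linarith⟩

/-- Other representatives of `d` modulo `2π` are strictly larger in modulus if `|d| < π`. -/
lemma eq_or_abs_lt_abs_sub {d : ℝ} (hd : |d| < π) (k : ℤ) :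
    d - 2 * π * k = d ∨ |d| < |d - 2 * π * k| := by
  rcases eq_or_ne k 0 with rfl | hk
  · simp
  · right
    have h1 : (1 : ℝ) ≤ |(k : ℝ)| := by exact_mod_cast Int.one_le_abs hk
    have h2 : |2 * π * (k : ℝ)| = 2 * π * |(k : ℝ)| := by
      rw [abs_mul, abs_of_pos (by positivity : (0 : ℝ) < 2 * π)]
    have h3 := abs_sub_abs_le_abs_sub (2 * π * (k : ℝ)) d
    rw [abs_sub_comm] at h3
    nlinarith [pi_pos]

/-- prox of the second-order cyclic difference on S¹, generic case
|(⟨x,w₂⟩)_{2π}| < π: the unique minimizer over y ∈ [−π,π)³ of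
(1/2)∑ dist(xⱼ,yⱼ)² + λ|(y₁−2y₂+y₃)_{2π}| is (x − s₂·m₂·w₂)_{2π} with
w₂ = (1,−2,1), s₂ = sgn((x₁−2x₂+x₃)_{2π}), m₂ = min{λ, |(x₁−2x₂+x₃)_{2π}|/6}. -/
theorem stmt8 (lam : ℝ) (hlam : 0 < lam) (x₁ x₂ x₃ : ℝ)
    (hx₁ : x₁ ∈ Ico (-π) π) (hx₂ : x₂ ∈ Ico (-π) π) (hx₃ : x₃ ∈ Ico (-π) π)
    (d m p₁ p₂ p₃ : ℝ)
    (hd : d = wrap (x₁ - 2 * x₂ + x₃))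
    (hdlt : |d| < π)
    (hm : m = min lam (|d| / 6))
    (hp₁ : p₁ = wrap (x₁ - Real.sign d * m))
    (hp₂ : p₂ = wrap (x₂ + 2 * (Real.sign d * m)))
    (hp₃ : p₃ = wrap (x₃ - Real.sign d * m))
    (F : ℝ → ℝ → ℝ → ℝ)
    (hF : ∀ y₁ y₂ y₃ : ℝ, F y₁ y₂ y₃ =
      (1 / 2) * (|wrap (x₁ - y₁)| ^ 2 + |wrap (x₂ - y₂)| ^ 2 +
        |wrap (x₃ - y₃)| ^ 2) + lam * |wrap (y₁ - 2 * y₂ + y₃)|) :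
    p₁ ∈ Ico (-π) π ∧ p₂ ∈ Ico (-π) π ∧ p₃ ∈ Ico (-π) π ∧
    (∀ y₁ ∈ Ico (-π) π, ∀ y₂ ∈ Ico (-π) π, ∀ y₃ ∈ Ico (-π) π,
      F p₁ p₂ p₃ ≤ F y₁ y₂ y₃) ∧
    (∀ y₁ ∈ Ico (-π) π, ∀ y₂ ∈ Ico (-π) π, ∀ y₃ ∈ Ico (-π) π,
      F y₁ y₂ y₃ = F p₁ p₂ p₃ → y₁ = p₁ ∧ y₂ = p₂ ∧ y₃ = p₃) := by
  have hm0 : 0 ≤ m := hm ▸ le_min hlam.le (by positivity)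
  have hmd : 6 * m ≤ |d| := by
    have : m ≤ |d| / 6 := hm ▸ min_le_right _ _
    linarith
  have hs : |Real.sign d * m| ≤ m ∧ (Real.sign d * m) ^ 2 = m ^ 2 ∧
      |d - 6 * (Real.sign d * m)| = |d| - 6 * m := by
    rcases lt_trichotomy d 0 with h | h | h
    · rw [abs_of_neg h] at hmd ⊢
      rw [Real.sign_of_neg h, abs_of_nonpos (by linarith : d - 6 * (-1 * m) ≤ 0),
        abs_of_nonpos (by linarith : -1 * m ≤ 0)]
      exact ⟨by linarith, by ring, by ring⟩
    · have : m = 0 := le_antisymm (by simp [h] at hmd; linarith) hm0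
      simp [h, this]
    · rw [abs_of_pos h] at hmd ⊢
      rw [Real.sign_of_pos h, one_mul, abs_of_nonneg hm0,
        abs_of_nonneg (by linarith : 0 ≤ d - 6 * m)]
      exact ⟨le_rfl, rfl, rfl⟩
  set u := Real.sign d * m with hu
  obtain ⟨hum, husq, hres⟩ := hs
  obtain ⟨hu1, hu2⟩ := abs_le.1 hum
  have hp₂' : p₂ = wrap (x₂ - -2 * u) := by rw [hp₂]; congr 1; ring
  obtain ⟨k, hk⟩ := exists_wrap_eq (x₁ - 2 * x₂ + x₃)
  have hFp : F p₁ p₂ p₃ = 3 * m ^ 2 + lam * (|d| - 6 * m) := by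
    have w₁ : wrap (x₁ - p₁) = u :=
      hp₁ ▸ wrap_sub_wrap_sub ⟨by linarith, by linarith⟩
    have w₂ : wrap (x₂ - p₂) = -2 * u :=
      hp₂' ▸ wrap_sub_wrap_sub ⟨by linarith, by linarith⟩
    have w₃ : wrap (x₃ - p₃) = u :=
      hp₃ ▸ wrap_sub_wrap_sub ⟨by linarith, by linarith⟩
    have w : wrap (p₁ - 2 * p₂ + p₃) = d - 6 * u := by
      obtain ⟨k₁, hk₁⟩ := exists_wrap_eq (x₁ - u)
      obtain ⟨k₂, hk₂⟩ := exists_wrap_eq (x₂ - -2 * u)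
      obtain ⟨k₃, hk₃⟩ := exists_wrap_eq (x₃ - u)
      have hlt : |d - 6 * u| < π := by linarith
      refine wrap_eq_of_eq_sub (k := k - k₁ + 2 * k₂ - k₃)
        ⟨(abs_lt.1 hlt).1.le, (abs_lt.1 hlt).2⟩ ?_
      push_cast
      rw [hp₁, hp₂', hp₃]
      linarith
    rw [hF, w₁, w₂, w₃, w, hres]
    simp only [sq_abs]
    linear_combination 3 * husq
  have key : ∀ y₁ y₂ y₃ : ℝ, F p₁ p₂ p₃ ≤ F y₁ y₂ y₃ ∧ (F y₁ y₂ y₃ = F p₁ p₂ p₃ →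
      wrap (x₁ - y₁) = u ∧ wrap (x₂ - y₂) = -2 * u ∧ wrap (x₃ - y₃) = u) := by
    intro y₁ y₂ y₃
    obtain ⟨k₁, hk₁⟩ := exists_wrap_eq (x₁ - y₁)
    obtain ⟨k₂, hk₂⟩ := exists_wrap_eq (x₂ - y₂)
    obtain ⟨k₃, hk₃⟩ := exists_wrap_eq (x₃ - y₃)
    obtain ⟨l, hl⟩ := exists_wrap_eq (y₁ - 2 * y₂ + y₃)
    have h := objective_min (v₁ := wrap (x₁ - y₁)) (v₂ := wrap (x₂ - y₂))
      (v₃ := wrap (x₃ - y₃)) hlam hm (eq_or_abs_lt_abs_sub hdlt (l - k + k₁ - 2 * k₂ + k₃))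
    have hw : d - 2 * π * ((l - k + k₁ - 2 * k₂ + k₃ : ℤ) : ℝ) -
        (wrap (x₁ - y₁) - 2 * wrap (x₂ - y₂) + wrap (x₃ - y₃)) =
        wrap (y₁ - 2 * y₂ + y₃) := by
      push_cast
      linarith
    rw [hw] at h
    rw [hFp, hF]
    simp only [sq_abs]
    exact h
  refine ⟨hp₁ ▸ wrap_mem _, hp₂ ▸ wrap_mem _, hp₃ ▸ wrap_mem _,
    fun y₁ _ y₂ _ y₃ _ => (key y₁ y₂ y₃).1, fun y₁ hy₁ y₂ hy₂ y₃ hy₃ heq => ?_⟩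
  obtain ⟨e₁, e₂, e₃⟩ := (key y₁ y₂ y₃).2 heq
  rw [hp₁, hp₂', hp₃, ← e₂]
  refine ⟨?_, eq_wrap_sub_wrap hy₂, ?_⟩
  · rw [← e₁]; exact eq_wrap_sub_wrap hy₁
  · rw [← e₃]; exact eq_wrap_sub_wrap hy₃
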